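/- arXiv:1510.08149 — 2 statements merged into one kernel-verified Lean document; each statement's English description precedes it below -/
import Mathlib

section
/- Let a be a 2-automatic sequence. Then a is homogeneous if and only if the following holds: the maps t_0 and t_1 are bijections of N(a), and the group G(a) of permutations of N(a) that they generate acts freely on N(a), i.e. whenever g ∈ G(a) satisfies g(u) = u for some u ∈ N(a), then g is the identity. (In other words, G(a) is a group and the Schreier graph Γ(a) is its Cayley graph.) -/
open scoped Classical

/-- `a k` encodes the term of index `k + 1` of a sequence `(a_n)_{n ≥ 1}` indexed from `1`.
`subSeq p a i j` encodes the subsequence `a^{(i,j)}` defined by `a^{(i,j)}_n = a_{p^i n + j}`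
for `n ≥ 1`. -/
def subSeq (p : ℕ) {Δ : Type*} (a : ℕ → Δ) (i j : ℕ) : ℕ → Δ :=
  fun k => a (p ^ i * (k + 1) + j - 1)

/-- `N(a)`: the set of all subsequences `a^{(i,j)}` with `0 ≤ j < p^i`. -/
def NSet (p : ℕ) {Δ : Type*} (a : ℕ → Δ) : Set (ℕ → Δ) :=
  {u | ∃ i j : ℕ, j < p ^ i ∧ u = subSeq p a i j}

/-- `a` is `p`-automatic iff `N(a)` is finite. -/
def IsAutomatic (p : ℕ) {Δ : Type*} (a : ℕ → Δ) : Prop :=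
  (NSet p a).Finite

/-- `rel(a)`: the set of relations of `a`: pairs `(i,j)` with `j < p^i`, `(i,j) ≠ (0,0)`
and `a^{(i,j)} = a`. -/
def relSet (p : ℕ) {Δ : Type*} (a : ℕ → Δ) : Set (ℕ × ℕ) :=
  {ij | ij.2 < p ^ ij.1 ∧ ij ≠ (0, 0) ∧ subSeq p a ij.1 ij.2 = a}

/-- `a` is homogeneous if every `u ∈ N(a)` satisfies `N(u) = N(a)` and `rel(u) = rel(a)`. -/
def Homogeneous (p : ℕ) {Δ : Type*} (a : ℕ → Δ) : Prop :=
  ∀ u ∈ NSet p a, NSet p u = NSet p a ∧ relSet p u = relSet p a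

theorem aux_comp {Δ : Type*} (u : ℕ → Δ) (i j i' j' : ℕ) :
    subSeq 2 (subSeq 2 u i j) i' j' = subSeq 2 u (i + i') (2 ^ i * j' + j) := by
  funext k
  unfold subSeq
  have h : 0 < 2 ^ i' * (k + 1) + j' := by positivity
  congr 2
  rw [Nat.sub_add_cancel h]
  ring

theorem aux_zero {Δ : Type*} (u : ℕ → Δ) : subSeq 2 u 0 0 = u := by
  funext k
  simp [subSeq]

theorem aux_lt {i j i' j' : ℕ} (h : j < 2 ^ i) (h' : j' < 2 ^ i') :
    2 ^ i * j' + j < 2 ^ (i + i') := by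
  have : 2 ^ i * (j' + 1) ≤ 2 ^ i * 2 ^ i' := Nat.mul_le_mul_left _ h'
  rw [pow_add]
  linarith

theorem aux_word {Δ : Type*} (w : List ℕ) (hw : ∀ d ∈ w, d < 2) :
    ∃ j < 2 ^ w.length, ∀ u : ℕ → Δ,
      w.foldl (fun v d => subSeq 2 v 1 d) u = subSeq 2 u w.length j := by
  induction w with
  | nil => exact ⟨0, by simp, fun u => by simp [aux_zero]⟩
  | cons d w ih =>
    obtain ⟨j, hj, h⟩ := ih (fun e he => hw e (by simp [he]))
    have hd : d < 2 ^ 1 := by simpa using hw d (by simp)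
    refine ⟨2 ^ 1 * j + d, ?_, fun u => ?_⟩
    · have := aux_lt hd hj
      rwa [List.length_cons, Nat.add_comm w.length 1]
    · rw [List.foldl_cons, h, aux_comp, List.length_cons, Nat.add_comm w.length 1]

theorem aux_word' {Δ : Type*} (i : ℕ) : ∀ j < 2 ^ i, ∃ w : List ℕ, (∀ d ∈ w, d < 2) ∧
    ∀ u : ℕ → Δ, w.foldl (fun v d => subSeq 2 v 1 d) u = subSeq 2 u i j := by
  induction i with
  | zero =>
    intro j hj
    have : j = 0 := by simpa using hj
    subst this
    exact ⟨[], by simp, fun u => by simp [aux_zero]⟩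
  | succ i ih =>
    intro j hj
    obtain ⟨w, hw, h⟩ := ih (j / 2) (by rw [pow_succ] at hj; omega)
    refine ⟨(j % 2) :: w, ?_, fun u => ?_⟩
    · intro d hd
      rcases List.mem_cons.1 hd with rfl | hd
      · omega
      · exact hw d hd
    · rw [List.foldl_cons, h, aux_comp, Nat.add_comm 1 i]
      congr 1
      omega

theorem aux_mem {Δ : Type*} {a u : ℕ → Δ} (hu : u ∈ NSet 2 a) {i j : ℕ} (hj : j < 2 ^ i) :
    subSeq 2 u i j ∈ NSet 2 a := by
  obtain ⟨i', j', h', rfl⟩ := hu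
  exact ⟨_, _, aux_lt h' hj, aux_comp _ _ _ _ _⟩

theorem aux_self {Δ : Type*} (a : ℕ → Δ) : a ∈ NSet 2 a :=
  ⟨0, 0, by simp, (aux_zero a).symm⟩

theorem aux_inj {Δ : Type*} {a : ℕ → Δ}
    (hb : ∀ i < 2, Set.BijOn (fun u => subSeq 2 u 1 i) (NSet 2 a) (NSet 2 a))
    (w : List ℕ) (hw : ∀ d ∈ w, d < 2) :
    Set.InjOn (fun u => w.foldl (fun v d => subSeq 2 v 1 d) u) (NSet 2 a) := by
  induction w with
  | nil => intro x _ y _ h; exact h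
  | cons d w ih =>
    have hd := hb d (hw d (by simp))
    intro x hx y hy h
    exact hd.injOn hx hy (ih (fun e he => hw e (by simp [he])) (hd.mapsTo hx) (hd.mapsTo hy) h)

theorem stmt_8 {Δ : Type*} [Finite Δ] (a : ℕ → Δ) (ha : IsAutomatic 2 a) :
    Homogeneous 2 a ↔
      ((∀ i < 2, Set.BijOn (fun u => subSeq 2 u 1 i) (NSet 2 a) (NSet 2 a)) ∧
        ∀ w : List ℕ, (∀ d ∈ w, d < 2) →
          (∃ u ∈ NSet 2 a, w.foldl (fun v d => subSeq 2 v 1 d) u = u) →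
            ∀ v ∈ NSet 2 a, w.foldl (fun v d => subSeq 2 v 1 d) v = v) := by
  have hfin : (NSet 2 a).Finite := ha
  constructor
  · intro H
    have key : ∀ i j, j < 2 ^ i → i ≠ 0 → ∀ u ∈ NSet 2 a, subSeq 2 u i j = u →
        ∀ v ∈ NSet 2 a, subSeq 2 v i j = v := by
      intro i j hj hi u hu h v hv
      have h1 : (i, j) ∈ relSet 2 u := ⟨hj, by simp [hi], h⟩
      rw [(H u hu).2, ← (H v hv).2] at h1
      exact h1.2.2
    refine ⟨fun i hi => ?_, fun w hw => ?_⟩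
    · have hi' : i < 2 ^ 1 := by simpa using hi
      have hm : Set.MapsTo (fun u => subSeq 2 u 1 i) (NSet 2 a) (NSet 2 a) :=
        fun u hu => aux_mem hu hi'
      have hinj : Set.InjOn (fun u => subSeq 2 u 1 i) (NSet 2 a) := by
        have h1 : a ∈ NSet 2 (subSeq 2 a 1 i) := by
          rw [(H _ (hm (aux_self a))).1]
          exact aux_self a
        obtain ⟨i', j', hj', h2⟩ := h1
        rw [aux_comp] at h2
        have h3 := key _ _ (aux_lt hi' hj') (by omega) a (aux_self a) h2.symm
        intro x hx y hy hxy
        rw [← h3 x hx, ← h3 y hy, ← aux_comp, ← aux_comp]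
        exact congrArg (fun z => subSeq 2 z i' j') hxy
      exact ⟨hm, hinj, (hfin.injOn_iff_bijOn_of_mapsTo hm |>.1 hinj).surjOn⟩
    · rintro ⟨u, hu, h⟩ v hv
      obtain ⟨j, hj, hw'⟩ := aux_word (Δ := Δ) w hw
      rcases w with _ | ⟨d, w⟩
      · rfl
      · rw [hw'] at h ⊢
        exact key _ _ hj (by simp) u hu h v hv
  · rintro ⟨hb, hf⟩ u hu
    have key : ∀ i j, j < 2 ^ i → ∀ u ∈ NSet 2 a, subSeq 2 u i j = u →
        ∀ v ∈ NSet 2 a, subSeq 2 v i j = v := by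
      intro i j hj u hu h v hv
      obtain ⟨w, hw, hw'⟩ := aux_word' (Δ := Δ) i j hj
      rw [← hw']
      exact hf w hw ⟨u, hu, by rw [hw', h]⟩ v hv
    constructor
    · have hau : a ∈ NSet 2 u := by
        obtain ⟨i, j, hj, rfl⟩ := hu
        obtain ⟨w, hw, hw'⟩ := aux_word' (Δ := Δ) i j hj
        have hinj := aux_inj hb w hw
        simp only [hw'] at hinj
        have hm : Set.MapsTo (fun u => subSeq 2 u i j) (NSet 2 a) (NSet 2 a) :=
          fun u hu => aux_mem hu hj
        have : Finite (NSet 2 a) := hfin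
        obtain ⟨n, hn, hp⟩ := (hm.restrict_inj.2 hinj).mem_periodicPts ⟨a, aux_self a⟩
        obtain ⟨m, rfl⟩ : ∃ m, n = m + 1 := ⟨n - 1, by omega⟩
        have h1 := congrArg Subtype.val hp
        rw [hm.iterate_restrict, Set.MapsTo.val_restrict_apply, Function.iterate_succ_apply] at h1
        have h2 : ∀ (m : ℕ) (v : ℕ → Δ), v ∈ NSet 2 (subSeq 2 a i j) →
            (fun u => subSeq 2 u i j)^[m] v ∈ NSet 2 (subSeq 2 a i j) := by
          intro m
          induction m with
          | zero => intro v hv; exact hv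
          | succ m ih => intro v hv; exact ih _ (aux_mem hv hj)
        have h3 := h2 m _ (aux_self _)
        simp only at h1
        rwa [h1] at h3
      ext v
      constructor
      · rintro ⟨i, j, hj, rfl⟩
        exact aux_mem hu hj
      · rintro ⟨i, j, hj, rfl⟩
        exact aux_mem hau hj
    · ext ⟨i, j⟩
      constructor
      · rintro ⟨hj, h0, h⟩
        exact ⟨hj, h0, key i j hj u hu h a (aux_self a)⟩
      · rintro ⟨hj, h0, h⟩
        exact ⟨hj, h0, key i j hj a (aux_self a) h u hu⟩
end

section
/- Let p ≥ 2, let G be a finite group generated by distinguished elements t_0, …, t_{p−1}, and let τ : G → Δ be a map into a finite alphabet Δ such that the subgroup H = { h ∈ G : τ(h g) = τ(g) for all g ∈ G } is normal in G. Let a be the sequence a_n = τ(t_{d_0} t_{d_1} ⋯ t_{d_k}), where d_k ⋯ d_0 are the base-p digits of n (d_0 least significant). Then a is p-automatic and homogeneous, each map t_i : N(a) → N(a) is a bijection, and the group G(a) of permutations of N(a) generated by the t_i acts freely on N(a) (so Γ(a) is the Cayley graph of G(a)). If moreover H = {1}, then there is a bijection β : G → N(a) with β(1) = a and β(g t_i)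 = t_i(β(g)) for all g ∈ G and 0 ≤ i < p, and the induced map G → G(a) carrying each generator t_i of G to the map t_i on N(a) is a group isomorphism. -/
open scoped Classical

/-- The subgroup `H` of all `h ∈ G` such that `τ (h * g) = τ g` for all `g ∈ G`. -/
def tauStab {G : Type*} [Group G] {Δ : Type*} (τ : G → Δ) : Subgroup G where
  carrier := {h | ∀ g, τ (h * g) = τ g}
  one_mem' := by intro g; rw [one_mul]
  mul_mem' := by
    intro x y hx hy g
    rw [mul_assoc, hx (y * g), hy g]
  inv_mem' := by
    intro x hx g
    have h1 := hx (x⁻¹ * g)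
    rw [mul_inv_cancel_left] at h1
    exact h1.symm

/-- The sequence produced by the automaton whose underlying graph is the Cayley graph of `G`
with distinguished generators `t 0, …, t (p-1)`, initial state `1` and labeling map `τ`:
`a_n = τ (t_{d_0} t_{d_1} ⋯ t_{d_k})` where `d_k ⋯ d_0` are the base-`p` digits of `n`. -/
def cayleySeq (p : ℕ) {G Δ : Type*} [Group G] (t : ℕ → G) (τ : G → Δ) : ℕ → Δ :=
  fun k => τ ((Nat.digits p (k + 1)).foldl (fun g d => g * t d) 1)

def bt (p : ℕ) {G Δ : Type*} [Group G] (t : ℕ → G) (τ : G → Δ) (g : G) : ℕ → Δ :=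
  fun k => τ (g * ((Nat.digits p (k + 1)).map t).prod)

theorem foldl_eq_prod {G : Type*} [Group G] (t : ℕ → G) (l : List ℕ) :
    ∀ g : G, l.foldl (fun g d => g * t d) g = g * (l.map t).prod := by
  induction l with
  | nil => simp
  | cons d l ih => intro g; simp [ih, mul_assoc]

theorem cayleySeq_eq (p : ℕ) {G Δ : Type*} [Group G] (t : ℕ → G) (τ : G → Δ) :
    cayleySeq p t τ = bt p t τ 1 := by
  funext k; simp only [cayleySeq, bt, foldl_eq_prod]

theorem bt_step {p : ℕ} (hp : 2 ≤ p) {G Δ : Type*} [Group G] (t : ℕ → G) (τ : G → Δ) (g : G)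
    (i : ℕ) (hi : i < p) : bt p t τ (g * t i) = subSeq p (bt p t τ g) 1 i := by
  funext k
  simp only [bt, subSeq, pow_one]
  have h0 : 0 < p * (k + 1) := by positivity
  have h1 : p * (k + 1) + i - 1 + 1 = i + p * (k + 1) := by omega
  rw [h1, Nat.digits_add p (by omega) i (k + 1) hi (Or.inr (by omega))]
  simp [mul_assoc]

theorem bt_word {p : ℕ} (hp : 2 ≤ p) {G Δ : Type*} [Group G] (t : ℕ → G) (τ : G → Δ)
    (w : List ℕ) : ∀ g : G, (∀ d ∈ w, d < p) →
    w.foldl (fun v d => subSeq p v 1 d) (bt p t τ g) = bt p t τ (g * (w.map t).prod) := by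
  induction w with
  | nil => intro g _; simp
  | cons d w ih =>
    intro g hw
    rw [List.foldl_cons, ← bt_step hp t τ g d (hw d (by simp)),
      ih _ (fun e he => hw e (by simp [he]))]
    simp [mul_assoc]

theorem subSeq_zero (p : ℕ) {Δ : Type*} (u : ℕ → Δ) : subSeq p u 0 0 = u := by
  funext k; simp [subSeq]

theorem subSeq_comp {p : ℕ} (hp : 2 ≤ p) {Δ : Type*} (u : ℕ → Δ) (i j d : ℕ) :
    subSeq p (subSeq p u 1 d) i j = subSeq p u (i + 1) (p * j + d) := by
  funext k
  simp only [subSeq, pow_one]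
  have h0 : 0 < p ^ i * (k + 1) := by positivity
  have h1 : p ^ i * (k + 1) + j - 1 + 1 = p ^ i * (k + 1) + j := by omega
  rw [h1]
  congr 2
  ring

theorem subSeq_word {p : ℕ} (hp : 2 ≤ p) (i : ℕ) : ∀ j, j < p ^ i →
    ∃ w : List ℕ, (∀ d ∈ w, d < p) ∧ ∀ {Δ : Type*} (u : ℕ → Δ),
      subSeq p u i j = w.foldl (fun v d => subSeq p v 1 d) u := by
  induction i with
  | zero =>
    intro j hj
    refine ⟨[], by simp, fun u => ?_⟩
    have : j = 0 := by simpa using hj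
    subst this
    simp [subSeq_zero]
  | succ i ih =>
    intro j hj
    obtain ⟨w, hw, h⟩ := ih (j / p) (by
      rw [Nat.div_lt_iff_lt_mul (by omega)]; rwa [pow_succ] at hj)
    refine ⟨(j % p) :: w, ?_, fun u => ?_⟩
    · intro d hd
      rcases List.mem_cons.1 hd with rfl | hd
      · exact Nat.mod_lt _ (by omega)
      · exact hw d hd
    · rw [List.foldl_cons, ← h, subSeq_comp hp, Nat.div_add_mod]

theorem word_subSeq {p : ℕ} (hp : 2 ≤ p) {Δ : Type*} (w : List ℕ) : (∀ d ∈ w, d < p) →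
    ∃ i j, j < p ^ i ∧ ∀ (u : ℕ → Δ),
      subSeq p u i j = w.foldl (fun v d => subSeq p v 1 d) u := by
  induction w with
  | nil => intro _; exact ⟨0, 0, by simp, fun u => by simp [subSeq_zero]⟩
  | cons d w ih =>
    intro hw
    obtain ⟨i, j, hj, h⟩ := ih (fun e he => hw e (by simp [he]))
    have hd := hw d (by simp)
    refine ⟨i + 1, p * j + d, ?_, fun u => ?_⟩
    · rw [pow_succ']
      calc p * j + d < p * (j + 1) := by rw [mul_add]; omega
        _ ≤ p * p ^ i := Nat.mul_le_mul_left _ hj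
    · rw [List.foldl_cons, ← h, subSeq_comp hp]

theorem exists_word {p : ℕ} {G : Type*} [Group G] [Finite G]
    (t : ℕ → G) (hgen : Subgroup.closure (t '' Set.Iio p) = ⊤) (x : G) :
    ∃ w : List ℕ, (∀ d ∈ w, d < p) ∧ (w.map t).prod = x := by
  have hx : x ∈ Submonoid.closure (t '' Set.Iio p) := by
    rw [← Subgroup.closure_toSubmonoid_of_finite, hgen]; simp
  induction hx using Submonoid.closure_induction with
  | mem x hx =>
    obtain ⟨d, hd, rfl⟩ := hx
    exact ⟨[d], by simpa using hd, by simp⟩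
  | one => exact ⟨[], by simp, by simp⟩
  | mul x y _ _ hx hy =>
    obtain ⟨w, hw, rfl⟩ := hx
    obtain ⟨v, hv, rfl⟩ := hy
    refine ⟨w ++ v, ?_, by simp⟩
    intro d hd
    rcases List.mem_append.1 hd with h | h
    · exact hw d h
    · exact hv d h

theorem exists_digits {p : ℕ} (hp : 2 ≤ p) {G : Type*} [Group G] [Finite G]
    (t : ℕ → G) (hgen : Subgroup.closure (t '' Set.Iio p) = ⊤) (x : G) :
    ∃ k : ℕ, ((Nat.digits p (k + 1)).map t).prod = x := by
  obtain ⟨w, hw, h⟩ := exists_word t hgen (x * (t 1)⁻¹)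
  have hd : Nat.digits p (Nat.ofDigits p (w ++ [1])) = w ++ [1] := by
    apply Nat.digits_ofDigits p (by omega)
    · intro d hd
      rcases List.mem_append.1 hd with h | h
      · exact hw d h
      · simp at h; omega
    · intro _; simp
  have hpos : Nat.ofDigits p (w ++ [1]) ≠ 0 := by
    intro h0; rw [h0] at hd; simp at hd
  refine ⟨Nat.ofDigits p (w ++ [1]) - 1, ?_⟩
  rw [Nat.sub_add_cancel (by omega), hd]
  simp [h]

theorem bt_eq_iff {p : ℕ} (hp : 2 ≤ p) {G Δ : Type*} [Group G] [Finite G]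
    (t : ℕ → G) (hgen : Subgroup.closure (t '' Set.Iio p) = ⊤) (τ : G → Δ) (g g' : G) :
    bt p t τ g = bt p t τ g' ↔ g * g'⁻¹ ∈ tauStab τ := by
  constructor
  · intro h y
    obtain ⟨k, hk⟩ := exists_digits hp t hgen (g'⁻¹ * y)
    have := congrFun h k
    simp only [bt, hk] at this
    simpa [mul_assoc] using this
  · intro h
    funext k
    have := h (g' * ((Nat.digits p (k + 1)).map t).prod)
    simpa [bt, mul_assoc] using this

theorem NSet_bt {p : ℕ} (hp : 2 ≤ p) {G Δ : Type*} [Group G] [Finite G]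
    (t : ℕ → G) (hgen : Subgroup.closure (t '' Set.Iio p) = ⊤) (τ : G → Δ) (g : G) :
    NSet p (bt p t τ g) = Set.range (bt p t τ) := by
  ext u
  constructor
  · rintro ⟨i, j, hj, rfl⟩
    obtain ⟨w, hw, h⟩ := subSeq_word hp i j hj
    exact ⟨_, by rw [h, bt_word hp t τ w g hw]⟩
  · rintro ⟨y, rfl⟩
    obtain ⟨w, hw, h⟩ := exists_word t hgen (g⁻¹ * y)
    obtain ⟨i, j, hj, h'⟩ := word_subSeq (Δ := Δ) hp w hw
    exact ⟨i, j, hj, by rw [h', bt_word hp t τ w g hw, h]; simp⟩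

/-- If `a` is produced by the Cayley-graph automaton of a finite group `G` with generators
`t 0, …, t (p-1)`, initial state `1` and labeling `τ` whose stabilizer subgroup
`H = {h | ∀ g, τ (h g) = τ g}` is normal, then `a` is `p`-automatic and homogeneous, the maps
`t_i` are bijections of `N(a)` and the group `G(a)` they generate (described through words in
the `t_i`) acts freely on `N(a)` (so `Γ(a)` is the Cayley graph of `G(a)`); if moreover
`H = {1}`, then `G` can be identified with `G(a)` and `Γ(a)` with the graph underlying the
automaton, via a bijection `β : G → N(a)` and the induced isomorphism `Φ` (with the
composition convention `u^{g h} = (u^g)^h`) carrying each generator `t i` to the map `t_i`. -/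
theorem stmt_10 {p : ℕ} (hp : 2 ≤ p) {G Δ : Type*} [Group G] [Finite G] [Finite Δ]
    (t : ℕ → G) (hgen : Subgroup.closure (t '' Set.Iio p) = ⊤)
    (τ : G → Δ) (hnormal : (tauStab τ).Normal)
    (a : ℕ → Δ) (haeq : a = cayleySeq p t τ) :
    IsAutomatic p a ∧ Homogeneous p a ∧
    (∀ i < p, Set.BijOn (fun u => subSeq p u 1 i) (NSet p a) (NSet p a)) ∧
    (∀ w : List ℕ, (∀ d ∈ w, d < p) →
      (∃ u ∈ NSet p a, w.foldl (fun v d => subSeq p v 1 d) u = u) →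
        ∀ v ∈ NSet p a, w.foldl (fun v d => subSeq p v 1 d) v = v) ∧
    (tauStab τ = ⊥ →
      ∃ β : G → (ℕ → Δ),
        β 1 = a ∧ Set.range β = NSet p a ∧ Function.Injective β ∧
        (∀ g : G, ∀ i < p, β (g * t i) = subSeq p (β g) 1 i) ∧
        ∃ Φ : G → ((ℕ → Δ) → (ℕ → Δ)),
          (∀ g x : G, Φ g (β x) = β (x * g)) ∧
          (∀ g₁ g₂ : G, (∀ u ∈ NSet p a, Φ g₁ u = Φ g₂ u) → g₁ = g₂) ∧
          (∀ g h : G, ∀ u ∈ NSet p a, Φ (g * h) u = Φ h (Φ g u)) ∧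
          (∀ i < p, ∀ u ∈ NSet p a, Φ (t i) u = subSeq p u 1 i) ∧
          (∀ g : G, ∃ w : List ℕ, (∀ d ∈ w, d < p) ∧
            ∀ u ∈ NSet p a, Φ g u = w.foldl (fun v d => subSeq p v 1 d) u) ∧
          (∀ w : List ℕ, (∀ d ∈ w, d < p) →
            ∃ g : G, ∀ u ∈ NSet p a, Φ g u = w.foldl (fun v d => subSeq p v 1 d) u)) := by
  have hN : NSet p a = Set.range (bt p t τ) := by
    rw [haeq, cayleySeq_eq, NSet_bt hp t hgen]
  have hE := bt_eq_iff hp t hgen τ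
  have hfix : ∀ g x : G, bt p t τ (g * x) = bt p t τ g ↔ x ∈ tauStab τ := by
    intro g x
    rw [hE]
    constructor
    · intro h
      have := hnormal.conj_mem _ h g⁻¹
      simpa [mul_assoc] using this
    · intro h
      exact hnormal.conj_mem _ h g
  refine ⟨?_, ?_, ?_, ?_, ?_⟩
  · rw [IsAutomatic, hN]; exact Set.finite_range _
  · intro u hu
    rw [hN] at hu
    obtain ⟨g, rfl⟩ := hu
    refine ⟨by rw [hN, NSet_bt hp t hgen], ?_⟩
    rw [haeq, cayleySeq_eq]
    ext ⟨i, j⟩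
    simp only [relSet, Set.mem_setOf_eq]
    refine and_congr_right fun hj => and_congr_right fun _ => ?_
    obtain ⟨w, hw, h⟩ := subSeq_word hp i j hj
    rw [h, h, bt_word hp t τ w _ hw, bt_word hp t τ w _ hw, hfix, hfix]
  · intro i hi
    rw [hN]
    refine ⟨?_, ?_, ?_⟩
    · rintro _ ⟨g, rfl⟩
      exact ⟨g * t i, bt_step hp t τ g i hi⟩
    · rintro _ ⟨g, rfl⟩ _ ⟨g', rfl⟩ h
      simp only [← bt_step hp t τ _ i hi] at h
      rw [hE] at h ⊢
      simpa [mul_assoc] using h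
    · rintro _ ⟨g, rfl⟩
      refine ⟨_, ⟨g * (t i)⁻¹, rfl⟩, ?_⟩
      simp only [← bt_step hp t τ _ i hi]
      simp
  · rw [hN]
    rintro w hw ⟨_, ⟨g, rfl⟩, h⟩ _ ⟨g', rfl⟩
    rw [bt_word hp t τ w _ hw, hfix] at h ⊢
    exact h
  · intro hbot
    have hinj : Function.Injective (bt p t τ) := by
      intro g g' h
      rw [hE, hbot, Subgroup.mem_bot] at h
      exact mul_inv_eq_one.1 h
    have hinv : ∀ x, Function.invFun (bt p t τ) (bt p t τ x) = x :=
      Function.leftInverse_invFun hinj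
    refine ⟨bt p t τ, by rw [haeq, cayleySeq_eq], hN.symm, hinj,
      fun g i hi => bt_step hp t τ g i hi,
      fun g u => bt p t τ (Function.invFun (bt p t τ) u * g), ?_, ?_, ?_, ?_, ?_, ?_⟩
    · intro g x; simp only [hinv]
    · intro g₁ g₂ h
      have := hinj (h (bt p t τ 1) (by rw [hN]; exact ⟨1, rfl⟩))
      exact mul_left_cancel this
    · intro g h u _
      simp only [hinv, mul_assoc]
    · rw [hN]
      rintro i hi _ ⟨g, rfl⟩
      simp only [hinv]
      exact bt_step hp t τ g i hi
    · intro g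
      obtain ⟨w, hw, h⟩ := exists_word t hgen g
      refine ⟨w, hw, ?_⟩
      rw [hN]
      rintro _ ⟨x, rfl⟩
      simp only [hinv]
      rw [bt_word hp t τ w _ hw, h]
    · intro w hw
      refine ⟨(w.map t).prod, ?_⟩
      rw [hN]
      rintro _ ⟨x, rfl⟩
      simp only [hinv]
      rw [bt_word hp t τ w _ hw]
end
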